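/- Let g = h·exp(a)·h⁻¹ ∈ SLₙ(ℝ) be loxodromic of positive type (h ∈ SLₙ(ℝ), a ∈ 𝔞 with a₁₁ > a₂₂ > ⋯ > aₙₙ), let Y ∈ 𝔰𝔩ₙ(ℝ), and let φ = (g,Y) be the corresponding affine transformation of 𝔰𝔩ₙ(ℝ). Suppose A₊ and A₋ are affine parabolic spaces with directions Ad(h)𝔟⁺ and Ad(h)𝔟⁻ respectively, satisfying φ(A₊) = A₊ and φ(A₋) = A₋. Let A be any affine parabolic space transverse to both A₊ and A₋ and such that φ(A) is transverse to A. Then A₊, A₋, φ(A), A are pairwise transverse affine parabolic spaces and β(A₊, A₋, φ(A), A) = M(g,Y) − ω₀ M(g,Y). -/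

import Mathlib

open Matrix

noncomputable section

abbrev Mn (n : ℕ) := Matrix (Fin n) (Fin n) ℝ

/-- Conjugation `Z ↦ g Z g⁻¹` as a linear map on matrices. -/
def AdM {n : ℕ} (g : Mn n) : Mn n →ₗ[ℝ] Mn n where
  toFun Z := g * Z * g⁻¹
  map_add' X Y := by simp [Matrix.add_mul, Matrix.mul_add]
  map_smul' c X := by simp [Matrix.smul_mul, Matrix.mul_smul]

/-- Projection onto the diagonal part. -/
def pi0 {n : ℕ} : Mn n →ₗ[ℝ] Mn n where
  toFun Z := Matrix.diagonal (fun i => Z i i)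
  map_add' X Y := by
    ext i j
    by_cases h : i = j <;> simp [Matrix.diagonal_apply, h]
  map_smul' c X := by
    ext i j
    by_cases h : i = j <;> simp [Matrix.diagonal_apply, h]

/-- The involution reversing the diagonal entries (on diagonal matrices). -/
def omega0 {n : ℕ} : Mn n →ₗ[ℝ] Mn n where
  toFun Z := Matrix.diagonal (fun i => Z i.rev i.rev)
  map_add' X Y := by
    ext i j
    by_cases h : i = j <;> simp [Matrix.diagonal_apply, h]
  map_smul' c X := by
    ext i j
    by_cases h : i = j <;> simp [Matrix.diagonal_apply, h]

/-- Traceless matrices: 𝔰𝔩ₙ(ℝ). -/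
def slSub (n : ℕ) : Submodule ℝ (Mn n) := LinearMap.ker (Matrix.traceLinearMap (Fin n) ℝ ℝ)

/-- Matrices vanishing below the diagonal (upper triangular). -/
def upTri (n : ℕ) : Submodule ℝ (Mn n) where
  carrier := {Z | ∀ i j : Fin n, j < i → Z i j = 0}
  add_mem' := by intro a b ha hb i j h; simp [Matrix.add_apply, ha i j h, hb i j h]
  zero_mem' := by intro i j h; rfl
  smul_mem' := by intro c a ha i j h; simp [Matrix.smul_apply, ha i j h]

/-- Matrices vanishing above the diagonal (lower triangular). -/
def loTri (n : ℕ) : Submodule ℝ (Mn n) where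
  carrier := {Z | ∀ i j : Fin n, i < j → Z i j = 0}
  add_mem' := by intro a b ha hb i j h; simp [Matrix.add_apply, ha i j h, hb i j h]
  zero_mem' := by intro i j h; rfl
  smul_mem' := by intro c a ha i j h; simp [Matrix.smul_apply, ha i j h]

/-- Diagonal matrices. -/
def diagSub (n : ℕ) : Submodule ℝ (Mn n) where
  carrier := {Z | ∀ i j : Fin n, i ≠ j → Z i j = 0}
  add_mem' := by intro a b ha hb i j h; simp [Matrix.add_apply, ha i j h, hb i j h]
  zero_mem' := by intro i j h; rfl
  smul_mem' := by intro c a ha i j h; simp [Matrix.smul_apply, ha i j h]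

/-- Strictly upper triangular matrices: 𝔫⁺. -/
def nplus (n : ℕ) : Submodule ℝ (Mn n) where
  carrier := {Z | ∀ i j : Fin n, j ≤ i → Z i j = 0}
  add_mem' := by intro a b ha hb i j h; simp [Matrix.add_apply, ha i j h, hb i j h]
  zero_mem' := by intro i j h; rfl
  smul_mem' := by intro c a ha i j h; simp [Matrix.smul_apply, ha i j h]

/-- Strictly lower triangular matrices: 𝔫⁻. -/
def nminus (n : ℕ) : Submodule ℝ (Mn n) where
  carrier := {Z | ∀ i j : Fin n, i ≤ j → Z i j = 0}
  add_mem' := by intro a b ha hb i j h; simp [Matrix.add_apply, ha i j h, hb i j h]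
  zero_mem' := by intro i j h; rfl
  smul_mem' := by intro c a ha i j h; simp [Matrix.smul_apply, ha i j h]

/-- 𝔟⁺ : traceless upper triangular matrices. -/
def bplus (n : ℕ) : Submodule ℝ (Mn n) := slSub n ⊓ upTri n

/-- 𝔟⁻ : traceless lower triangular matrices. -/
def bminus (n : ℕ) : Submodule ℝ (Mn n) := slSub n ⊓ loTri n

/-- 𝔞 : traceless diagonal matrices. -/
def aSub (n : ℕ) : Submodule ℝ (Mn n) := slSub n ⊓ diagSub n

/-- A parabolic subspace of 𝔰𝔩ₙ(ℝ): a subspace of the form Ad(g)𝔟⁺ with g ∈ SLₙ(ℝ). -/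
def IsParabolic {n : ℕ} (V : Submodule ℝ (Mn n)) : Prop :=
  ∃ g : Mn n, g.det = 1 ∧ V = (bplus n).map (AdM g)

/-- Two subspaces are transverse if together they span 𝔰𝔩ₙ(ℝ). -/
def Transv {n : ℕ} (V W : Submodule ℝ (Mn n)) : Prop := V ⊔ W = slSub n

/-- A standardizer of an ordered transverse pair of parabolic subspaces. -/
def IsStd {n : ℕ} (h : Mn n) (V₁ V₂ : Submodule ℝ (Mn n)) : Prop :=
  h.det = 1 ∧ (bplus n).map (AdM h) = V₁ ∧ (bminus n).map (AdM h) = V₂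

/-- ν*_{i,j} computed with the standardizer h. -/
def nustar {n : ℕ} (h : Mn n) : Mn n →ₗ[ℝ] Mn n := pi0 ∘ₗ AdM h⁻¹

/-- ν_{i,j} computed with the standardizer h. -/
def nuMap {n : ℕ} (h : Mn n) : Mn n →ₗ[ℝ] Mn n := AdM h ∘ₗ pi0

/-- π_{i,j} computed with the standardizer h. -/
def piStd {n : ℕ} (h : Mn n) : Mn n →ₗ[ℝ] Mn n := AdM h ∘ₗ pi0 ∘ₗ AdM h⁻¹

/-- The commutator subspace [V,V]. -/
def commSub {n : ℕ} (V : Submodule ℝ (Mn n)) : Submodule ℝ (Mn n) :=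
  Submodule.span ℝ {z | ∃ x ∈ V, ∃ y ∈ V, z = x * y - y * x}

/-- An affine parabolic space with direction V: an affine subspace X + V of 𝔰𝔩ₙ(ℝ)
whose direction V is a parabolic subspace. -/
def IsAffPara {n : ℕ} (A : Set (Mn n)) (V : Submodule ℝ (Mn n)) : Prop :=
  IsParabolic V ∧ ∃ X : Mn n, X ∈ slSub n ∧ A = {Z | Z - X ∈ V}

/-- `IsCross b A₁ A₂ A₃ A₄ V₁ V₂ V₃ V₄` : b is a value of the affine cross ratio
β(A₁,A₂,A₃,A₄), computed with some choice of standardizers and intersection points. -/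
def IsCross {n : ℕ} (b : Mn n) (A₁ A₂ A₃ A₄ : Set (Mn n))
    (V₁ V₂ V₃ V₄ : Submodule ℝ (Mn n)) : Prop :=
  ∃ h₁₄ h₂₃ : Mn n, ∃ X₁₃ X₂₄ : Mn n,
    IsStd h₁₄ V₁ V₄ ∧ IsStd h₂₃ V₂ V₃ ∧ X₁₃ ∈ A₁ ∩ A₃ ∧ X₂₄ ∈ A₂ ∩ A₄ ∧
    b = nustar h₁₄ (X₁₃ - X₂₄) - nustar h₂₃ (X₁₃ - X₂₄)

/-- `IsTriple d A₂ A₃ A₄ V₂ V₃ V₄` : d is a value of the affine triple ratio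
δ(A₂,A₃,A₄), computed with some choice of standardizers and points. -/
def IsTriple {n : ℕ} (d : Mn n) (A₂ A₃ A₄ : Set (Mn n))
    (V₂ V₃ V₄ : Submodule ℝ (Mn n)) : Prop :=
  ∃ h₂₃ h₃₂ h₃₄ h₄₃ h₄₂ h₂₄ : Mn n, ∃ X₂ X₃ X₄ : Mn n,
    IsStd h₂₃ V₂ V₃ ∧ IsStd h₃₂ V₃ V₂ ∧ IsStd h₃₄ V₃ V₄ ∧ IsStd h₄₃ V₄ V₃ ∧
    IsStd h₄₂ V₄ V₂ ∧ IsStd h₂₄ V₂ V₄ ∧ X₂ ∈ A₂ ∧ X₃ ∈ A₃ ∧ X₄ ∈ A₄ ∧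
    d = (nustar h₂₃ (X₂ - X₃) + nustar h₃₂ (X₂ - X₃))
      + (nustar h₃₄ (X₃ - X₄) + nustar h₄₃ (X₃ - X₄))
      + (nustar h₄₂ (X₄ - X₂) + nustar h₂₄ (X₄ - X₂))

/-- The affine action of (g,Y) ∈ SLₙ(ℝ) ⋉ 𝔰𝔩ₙ(ℝ) on 𝔰𝔩ₙ(ℝ). -/
def affMap {n : ℕ} (g Y : Mn n) : Mn n → Mn n := fun Z => g * Z * g⁻¹ + Y

lemma AdM_apply {n : ℕ} (g Z : Mn n) : AdM g Z = g * Z * g⁻¹ := rfl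

lemma AdM_mul {n : ℕ} (g k : Mn n) : AdM (g * k) = AdM g ∘ₗ AdM k := by
  ext1 Z
  simp only [LinearMap.comp_apply, AdM_apply, Matrix.mul_inv_rev, Matrix.mul_assoc]

lemma map_AdM_mul {n : ℕ} (g k : Mn n) (V : Submodule ℝ (Mn n)) :
    V.map (AdM (g * k)) = (V.map (AdM k)).map (AdM g) := by
  rw [AdM_mul, Submodule.map_comp]

lemma AdM_one {n : ℕ} : AdM (1 : Mn n) = LinearMap.id := by
  ext1 Z
  simp [AdM_apply]

lemma AdM_inv_comp {n : ℕ} {g : Mn n} (hg : g.det = 1) : AdM g⁻¹ ∘ₗ AdM g = LinearMap.id := by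
  rw [← AdM_mul, Matrix.nonsing_inv_mul g (by simp [hg]), AdM_one]

lemma AdM_comp_inv {n : ℕ} {g : Mn n} (hg : g.det = 1) : AdM g ∘ₗ AdM g⁻¹ = LinearMap.id := by
  rw [← AdM_mul, Matrix.mul_nonsing_inv g (by simp [hg]), AdM_one]

lemma AdM_inv_AdM {n : ℕ} {g : Mn n} (hg : g.det = 1) (Z : Mn n) : AdM g⁻¹ (AdM g Z) = Z :=
  LinearMap.congr_fun (AdM_inv_comp hg) Z

lemma AdM_AdM_inv {n : ℕ} {g : Mn n} (hg : g.det = 1) (Z : Mn n) : AdM g (AdM g⁻¹ Z) = Z :=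
  LinearMap.congr_fun (AdM_comp_inv hg) Z

lemma det_inv_eq_one {n : ℕ} {g : Mn n} (hg : g.det = 1) : g⁻¹.det = 1 := by
  simp [Matrix.det_nonsing_inv, hg]

lemma mem_slSub {n : ℕ} {Z : Mn n} : Z ∈ slSub n ↔ Z.trace = 0 := by
  simp [slSub]

lemma trace_AdM {n : ℕ} {g : Mn n} (hg : g.det = 1) (Z : Mn n) :
    (AdM g Z).trace = Z.trace := by
  rw [AdM_apply, Matrix.trace_mul_comm, ← Matrix.mul_assoc,
    Matrix.nonsing_inv_mul g (by simp [hg]), Matrix.one_mul]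

lemma map_AdM_slSub {n : ℕ} {g : Mn n} (hg : g.det = 1) : (slSub n).map (AdM g) = slSub n := by
  ext Z
  refine ⟨?_, fun hZ => ⟨AdM g⁻¹ Z, ?_, AdM_AdM_inv hg Z⟩⟩
  · rintro ⟨W, hW, rfl⟩
    exact mem_slSub.2 ((trace_AdM hg W).trans (mem_slSub.1 hW))
  · exact mem_slSub.2 ((trace_AdM (det_inv_eq_one hg) Z).trans (mem_slSub.1 hZ))

lemma Transv.map_AdM {n : ℕ} {V W : Submodule ℝ (Mn n)} (hVW : Transv V W) {g : Mn n}
    (hg : g.det = 1) : Transv (V.map (AdM g)) (W.map (AdM g)) := by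
  rw [Transv, ← Submodule.map_sup, hVW, map_AdM_slSub hg]

lemma Transv.symm {n : ℕ} {V W : Submodule ℝ (Mn n)} (hVW : Transv V W) : Transv W V := by
  rw [Transv, sup_comm, hVW]

lemma transv_bplus_bminus (n : ℕ) : Transv (bplus n) (bminus n) := by
  refine le_antisymm (sup_le inf_le_left inf_le_left) fun Z hZ => ?_
  rw [mem_slSub] at hZ
  refine Submodule.mem_sup.2
    ⟨Matrix.of fun i j => if i ≤ j then Z i j else 0, ⟨mem_slSub.2 ?_, ?_⟩,
      Matrix.of fun i j => if i ≤ j then 0 else Z i j, ⟨mem_slSub.2 ?_, ?_⟩, ?_⟩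
  · simpa [Matrix.trace] using hZ
  · intro i j hij
    simp [not_le.2 hij]
  · simp [Matrix.trace]
  · intro i j hij
    simp [hij.le]
  · ext i j
    by_cases hij : i ≤ j <;> simp [hij]

lemma ne_zero_of_det_diagonal {n : ℕ} {d : Fin n → ℝ} (hd : (Matrix.diagonal d).det = 1) :
    ∀ i, d i ≠ 0 := by
  rw [Matrix.det_diagonal] at hd
  intro i hi
  rw [Finset.prod_eq_zero (Finset.mem_univ i) hi] at hd
  exact zero_ne_one hd

lemma inv_diagonal_eq {n : ℕ} {d : Fin n → ℝ} (hd : (Matrix.diagonal d).det = 1) :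
    (Matrix.diagonal d)⁻¹ = Matrix.diagonal fun i => (d i)⁻¹ := by
  refine Matrix.inv_eq_right_inv ?_
  rw [Matrix.diagonal_mul_diagonal, ← Matrix.diagonal_one]
  congr 1
  ext i
  exact mul_inv_cancel₀ (ne_zero_of_det_diagonal hd i)

lemma AdM_diagonal_apply {n : ℕ} {d : Fin n → ℝ} (hd : (Matrix.diagonal d).det = 1)
    (Z : Mn n) (i j : Fin n) : AdM (Matrix.diagonal d) Z i j = d i * Z i j * (d j)⁻¹ := by
  rw [AdM_apply, inv_diagonal_eq hd, Matrix.mul_diagonal, Matrix.diagonal_mul]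

lemma pi0_AdM_diagonal {n : ℕ} {d : Fin n → ℝ} (hd : (Matrix.diagonal d).det = 1)
    (Z : Mn n) : pi0 (AdM (Matrix.diagonal d) Z) = pi0 Z := by
  simp only [pi0, LinearMap.coe_mk, AddHom.coe_mk]
  congr 1
  ext i
  rw [AdM_diagonal_apply hd, mul_right_comm, mul_inv_cancel₀ (ne_zero_of_det_diagonal hd i), one_mul]

/-- A subspace stable under conjugation by `g` and by `g⁻¹` is equal to its conjugate by `g`. -/
lemma map_AdM_eq_of_le {n : ℕ} {g : Mn n} (hg : g.det = 1) {V : Submodule ℝ (Mn n)}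
    (hV : V.map (AdM g) ≤ V) (hV' : V.map (AdM g⁻¹) ≤ V) : V.map (AdM g) = V :=
  le_antisymm hV fun Z hZ =>
    ⟨AdM g⁻¹ Z, hV' (Submodule.mem_map_of_mem hZ), AdM_AdM_inv hg Z⟩

lemma map_AdM_diagonal_bplus_le {n : ℕ} {d : Fin n → ℝ} (hd : (Matrix.diagonal d).det = 1) :
    (bplus n).map (AdM (Matrix.diagonal d)) ≤ bplus n := by
  rintro _ ⟨W, ⟨hW, hW'⟩, rfl⟩
  refine ⟨mem_slSub.2 ((trace_AdM hd W).trans (mem_slSub.1 hW)), fun i j hij => ?_⟩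
  rw [AdM_diagonal_apply hd, hW' i j hij, mul_zero, zero_mul]

lemma map_AdM_diagonal_bminus_le {n : ℕ} {d : Fin n → ℝ} (hd : (Matrix.diagonal d).det = 1) :
    (bminus n).map (AdM (Matrix.diagonal d)) ≤ bminus n := by
  rintro _ ⟨W, ⟨hW, hW'⟩, rfl⟩
  refine ⟨mem_slSub.2 ((trace_AdM hd W).trans (mem_slSub.1 hW)), fun i j hij => ?_⟩
  rw [AdM_diagonal_apply hd, hW' i j hij, mul_zero, zero_mul]

lemma map_AdM_diagonal_bplus {n : ℕ} {d : Fin n → ℝ} (hd : (Matrix.diagonal d).det = 1) :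
    (bplus n).map (AdM (Matrix.diagonal d)) = bplus n := by
  refine map_AdM_eq_of_le hd (map_AdM_diagonal_bplus_le hd) ?_
  have hd' := det_inv_eq_one hd
  rw [inv_diagonal_eq hd] at hd' ⊢
  exact map_AdM_diagonal_bplus_le hd'

lemma map_AdM_diagonal_bminus {n : ℕ} {d : Fin n → ℝ} (hd : (Matrix.diagonal d).det = 1) :
    (bminus n).map (AdM (Matrix.diagonal d)) = bminus n := by
  refine map_AdM_eq_of_le hd (map_AdM_diagonal_bminus_le hd) ?_
  have hd' := det_inv_eq_one hd
  rw [inv_diagonal_eq hd] at hd' ⊢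
  exact map_AdM_diagonal_bminus_le hd'

lemma map_AdM_conj {n : ℕ} {h d : Mn n} (hh : h.det = 1) {V : Submodule ℝ (Mn n)}
    (hV : V.map (AdM d) = V) : (V.map (AdM h)).map (AdM (h * d * h⁻¹)) = V.map (AdM h) := by
  rw [← map_AdM_mul, Matrix.mul_assoc, Matrix.mul_assoc, Matrix.nonsing_inv_mul h (by simp [hh]),
    Matrix.mul_one, map_AdM_mul, hV]

lemma det_conj_diagonal {n : ℕ} {h : Mn n} (hh : h.det = 1) {d : Mn n} (hd : d.det = 1) :
    (h * d * h⁻¹).det = 1 := by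
  rw [Matrix.det_mul, Matrix.det_mul, hh, hd, det_inv_eq_one hh, one_mul, one_mul]

lemma IsAffPara.image_affMap {n : ℕ} {A : Set (Mn n)} {V : Submodule ℝ (Mn n)}
    (hA : IsAffPara A V) {g Y : Mn n} (hg : g.det = 1) (hY : Y.trace = 0) :
    IsAffPara (affMap g Y '' A) (V.map (AdM g)) := by
  obtain ⟨⟨k, hk, rfl⟩, X, hX, rfl⟩ := hA
  refine ⟨⟨g * k, by rw [Matrix.det_mul, hg, hk, one_mul], (map_AdM_mul g k _).symm⟩,
    affMap g Y X, ?_, ?_⟩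
  · rw [mem_slSub] at hX ⊢
    rw [affMap, Matrix.trace_add, hY, add_zero, ← AdM_apply, trace_AdM hg, hX]
  · ext Z
    constructor
    · rintro ⟨W, hW, rfl⟩
      refine ⟨W - X, hW, ?_⟩
      rw [map_sub, AdM_apply, AdM_apply, affMap, affMap, add_sub_add_right_eq_sub]
    · rintro ⟨W, hW, hWZ⟩
      refine ⟨X + W, by simpa using hW, ?_⟩
      rw [affMap, ← AdM_apply, map_add, hWZ, affMap, AdM_apply]
      abel

lemma IsAffPara.sub_mem {n : ℕ} {A : Set (Mn n)} {V : Submodule ℝ (Mn n)}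
    (hA : IsAffPara A V) {Z W : Mn n} (hZ : Z ∈ A) (hW : W ∈ A) : Z - W ∈ V := by
  obtain ⟨-, X, -, rfl⟩ := hA
  simpa using V.sub_mem hZ hW

lemma affMap_sub_affMap {n : ℕ} (g Y Z W : Mn n) :
    affMap g Y Z - affMap g Y W = AdM g (Z - W) := by
  rw [map_sub, AdM_apply, AdM_apply, affMap, affMap, add_sub_add_right_eq_sub]

lemma affMap_injective {n : ℕ} {g : Mn n} (hg : g.det = 1) (Y : Mn n) :
    Function.Injective (affMap g Y) := by
  intro Z W hZW
  have := AdM_inv_AdM hg (Z - W)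
  rw [← affMap_sub_affMap g Y, hZW, sub_self, map_zero] at this
  exact (sub_eq_zero.1 this.symm)

/-- If conjugation by `k` (with inverse `m`) preserves lower triangularity, then `k` and `m`
are lower triangular. -/
lemma loTri_of_conj {n : ℕ} {k m : Mn n} (hmk : m * k = 1)
    (H : ∀ w ∈ loTri n, k * w * m ∈ loTri n) : k ∈ loTri n ∧ m ∈ loTri n := by
  have hv : ∀ i j p q : Fin n, j ≤ i → p < q → k p i * m j q = 0 := by
    intro i j p q hji hpq
    have hw : Matrix.single i j (1 : ℝ) ∈ loTri n := by
      intro s t hst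
      refine Matrix.single_apply_of_ne _ _ _ _ _ ?_
      rintro ⟨rfl, rfl⟩
      exact absurd hst (not_lt.2 hji)
    have := H _ hw p q hpq
    rw [Matrix.mul_assoc, Matrix.mul_apply, Finset.sum_eq_single i] at this
    · simpa using this
    · intro s _ hs
      rw [Matrix.single_mul_apply_of_ne _ _ _ _ _ hs, mul_zero]
    · simp
  have hsum : ∀ i j, ∑ q, m j q * k q i = (1 : Mn n) j i := fun i j => by
    rw [← hmk, Matrix.mul_apply]
  have hex : ∀ i, ∃ q, m i q * k q i ≠ 0 := by
    intro i
    by_contra! hc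
    have := hsum i i
    simp [hc] at this
  choose σ hσ using hex
  have hm : ∀ i j q, j ≤ i → σ i < q → m j q = 0 := fun i j q hji hq =>
    (mul_eq_zero.1 (hv i j _ q hji hq)).resolve_left (right_ne_zero_of_mul (hσ i))
  have hk : ∀ i j p, j ≤ i → p < σ j → k p i = 0 := fun i j p hji hp =>
    (mul_eq_zero.1 (hv i j p _ hji hp)).resolve_right (left_ne_zero_of_mul (hσ j))
  have hmono : StrictMono σ := by
    intro j i hji
    have hle : σ j ≤ σ i :=
      not_lt.1 fun hlt => left_ne_zero_of_mul (hσ j) (hm i j _ hji.le hlt)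
    refine lt_of_le_of_ne hle fun heq => ?_
    have h0 := hsum i j
    rw [Finset.sum_eq_single (σ j), Matrix.one_apply_ne hji.ne] at h0
    · refine mul_ne_zero (left_ne_zero_of_mul (hσ j)) ?_ h0
      rw [heq]
      exact right_ne_zero_of_mul (hσ i)
    · intro q _ hq
      rcases lt_or_gt_of_ne hq with hlt | hlt
      · rw [hk i j q hji.le hlt, mul_zero]
      · rw [hm j j q le_rfl hlt, zero_mul]
    · simp
  have hid : σ = id := by
    refine (hmono.range_inj strictMono_id).1 ?_
    rw [Set.range_id, (Finite.injective_iff_surjective.1 hmono.injective).range_eq]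
  exact ⟨fun p i hpi => hk i i p le_rfl (by simpa [hid] using hpi),
    fun j q hjq => hm j j q le_rfl (by simpa [hid] using hjq)⟩

lemma mul_mem_loTri {n : ℕ} {A B : Mn n} (hA : A ∈ loTri n) (hB : B ∈ loTri n) :
    A * B ∈ loTri n := by
  intro i j hij
  rw [Matrix.mul_apply]
  refine Finset.sum_eq_zero fun l _ => ?_
  rcases lt_or_ge i l with hl | hl
  · rw [hA i l hl, zero_mul]
  · rw [hB l j (hl.trans_lt hij), mul_zero]

lemma mul_diag_of_mem_loTri {n : ℕ} {A B : Mn n} (hA : A ∈ loTri n) (hB : B ∈ loTri n)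
    (i : Fin n) : (A * B) i i = A i i * B i i := by
  rw [Matrix.mul_apply, Finset.sum_eq_single i]
  · intro l _ hl
    rcases lt_or_gt_of_ne hl with hl | hl
    · rw [hB l i hl, mul_zero]
    · rw [hA i l hl, zero_mul]
  · simp

lemma conj_diag_of_loTri {n : ℕ} {k m : Mn n} (hmk : m * k = 1)
    (H : ∀ w ∈ loTri n, k * w * m ∈ loTri n) {w : Mn n} (hw : w ∈ loTri n) (i : Fin n) :
    (k * w * m) i i = w i i := by
  obtain ⟨hk, hm⟩ := loTri_of_conj hmk H
  have h1 : m i i * k i i = 1 := by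
    rw [← mul_diag_of_mem_loTri hm hk, hmk, Matrix.one_apply_eq]
  rw [mul_diag_of_mem_loTri (mul_mem_loTri hk hw) hm, mul_diag_of_mem_loTri hk hw]
  linear_combination w i i * h1

lemma submatrix_rev_mem_loTri {n : ℕ} {Z : Mn n} (hZ : Z ∈ upTri n) :
    Z.submatrix Fin.rev Fin.rev ∈ loTri n :=
  fun i j hij => hZ i.rev j.rev (Fin.rev_lt_rev.2 hij)

lemma submatrix_rev_mem_upTri {n : ℕ} {Z : Mn n} (hZ : Z ∈ loTri n) :
    Z.submatrix Fin.rev Fin.rev ∈ upTri n :=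
  fun i j hij => hZ i.rev j.rev (Fin.rev_lt_rev.2 hij)

lemma conj_diag_of_upTri_loTri {n : ℕ} {k m : Mn n} (hmk : m * k = 1)
    (H : ∀ w ∈ upTri n, k * w * m ∈ loTri n) {w : Mn n} (hw : w ∈ upTri n) (i : Fin n) :
    (k * w * m) i i = w i.rev i.rev := by
  have hprod : ∀ w : Mn n, k.submatrix id Fin.revPerm * w.submatrix Fin.revPerm Fin.revPerm *
      m.submatrix Fin.revPerm id = k * w * m := fun w => by
    rw [Matrix.submatrix_mul_equiv, Matrix.submatrix_mul_equiv, Matrix.submatrix_id_id]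
  have hinv : m.submatrix Fin.revPerm id * k.submatrix id Fin.revPerm = 1 := by
    rw [← Matrix.submatrix_mul _ _ _ _ _ Function.bijective_id, hmk, Matrix.submatrix_one_equiv]
  have := conj_diag_of_loTri hinv (fun w hw => by
    have h1 := hprod (w.submatrix Fin.rev Fin.rev)
    have h2 : (w.submatrix Fin.rev Fin.rev).submatrix Fin.revPerm Fin.revPerm = w := by
      ext i j
      simp
    rw [h2] at h1
    rw [h1]
    exact H _ (submatrix_rev_mem_upTri hw)) (submatrix_rev_mem_loTri hw) i
  rw [← hprod]
  exact this

lemma conj_diag_of_upTri {n : ℕ} {k m : Mn n} (hmk : m * k = 1)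
    (H : ∀ w ∈ upTri n, k * w * m ∈ upTri n) {w : Mn n} (hw : w ∈ upTri n) (i : Fin n) :
    (k * w * m) i i = w i i := by
  have hprod : ∀ w : Mn n, k.submatrix Fin.revPerm id * w * m.submatrix id Fin.revPerm =
      (k * w * m).submatrix Fin.revPerm Fin.revPerm := fun w => by
    rw [Matrix.submatrix_mul _ _ _ _ _ Function.bijective_id,
      Matrix.submatrix_mul _ _ _ _ _ Function.bijective_id, Matrix.submatrix_id_id]
  have hinv : m.submatrix id Fin.revPerm * k.submatrix Fin.revPerm id = 1 := by
    rw [Matrix.submatrix_mul_equiv, hmk, Matrix.submatrix_id_id]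
  have := conj_diag_of_upTri_loTri hinv (fun w hw => by
    rw [hprod]
    exact submatrix_rev_mem_loTri (H w hw)) hw i.rev
  rw [hprod] at this
  simpa using this

/-- Remove the trace condition from an inclusion between conjugates of triangular subspaces. -/
lemma AdM_mem_of_inf_slSub {n : ℕ} (hn : n ≠ 0) {k : Mn n} (hk : k.det = 1)
    {V W : Submodule ℝ (Mn n)} (hV : 1 ∈ V) (hW : 1 ∈ W)
    (H : ∀ w ∈ slSub n ⊓ V, AdM k w ∈ slSub n ⊓ W) : ∀ w ∈ V, AdM k w ∈ W := by
  intro w hw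
  have hn' : (n : ℝ) ≠ 0 := by exact_mod_cast hn
  have h0 : w - (w.trace / n) • (1 : Mn n) ∈ slSub n ⊓ V := by
    refine ⟨mem_slSub.2 ?_, V.sub_mem hw (V.smul_mem _ hV)⟩
    simp [Matrix.trace_sub, Matrix.trace_smul, hn']
  have h1 : AdM k 1 = 1 := by
    rw [AdM_apply, Matrix.mul_one, Matrix.mul_nonsing_inv k (by simp [hk])]
  have h2 := W.add_mem (H _ h0).2 (W.smul_mem (w.trace / n) hW)
  rwa [map_sub, map_smul, h1, sub_add_cancel] at h2

lemma one_mem_upTri (n : ℕ) : (1 : Mn n) ∈ upTri n := fun _ _ hij => Matrix.one_apply_ne hij.ne'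

lemma one_mem_loTri (n : ℕ) : (1 : Mn n) ∈ loTri n := fun _ _ hij => Matrix.one_apply_ne hij.ne

lemma nustar_AdM {n : ℕ} (h k w : Mn n) : nustar h (AdM k w) = pi0 (AdM (h⁻¹ * k) w) := by
  rw [AdM_mul]
  rfl

lemma AdM_inv_mul_mem {n : ℕ} {h k : Mn n} (hh : h.det = 1) {V W : Submodule ℝ (Mn n)}
    (H : W.map (AdM h) = V.map (AdM k)) : ∀ w ∈ V, AdM (h⁻¹ * k) w ∈ W := by
  intro w hw
  have : AdM k w ∈ W.map (AdM h) := H ▸ Submodule.mem_map_of_mem hw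
  obtain ⟨v, hv, hvw⟩ := this
  rw [AdM_mul, LinearMap.comp_apply, ← hvw, AdM_inv_AdM hh]
  exact hv

lemma det_inv_mul {n : ℕ} {h k : Mn n} (hh : h.det = 1) (hk : k.det = 1) :
    (h⁻¹ * k).det = 1 := by
  rw [Matrix.det_mul, det_inv_eq_one hh, hk, one_mul]

lemma inv_mul_self_of_det {n : ℕ} {k : Mn n} (hk : k.det = 1) : k⁻¹ * k = 1 :=
  Matrix.nonsing_inv_mul k (by simp [hk])

lemma nustar_AdM_self {n : ℕ} {k : Mn n} (hk : k.det = 1) (w : Mn n) :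
    nustar k (AdM k w) = pi0 w := by
  rw [nustar_AdM, inv_mul_self_of_det hk, AdM_one, LinearMap.id_apply]

/-- On `Ad(k)𝔟⁺` the map `ν*` depends only on the subspace. -/
lemma nustar_eq_of_map_bplus {n : ℕ} (hn : n ≠ 0) {h k : Mn n} (hh : h.det = 1) (hk : k.det = 1)
    (H : (bplus n).map (AdM h) = (bplus n).map (AdM k)) {Z : Mn n}
    (hZ : Z ∈ (bplus n).map (AdM k)) : nustar h Z = nustar k Z := by
  obtain ⟨w, hw, rfl⟩ := hZ
  have hd := det_inv_mul hh hk
  rw [nustar_AdM_self hk, nustar_AdM]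
  exact congrArg Matrix.diagonal (funext (conj_diag_of_upTri (inv_mul_self_of_det hd)
    (AdM_mem_of_inf_slSub hn hd (one_mem_upTri n) (one_mem_upTri n) (AdM_inv_mul_mem hh H)) hw.2))

/-- On `Ad(k)𝔟⁻` the map `ν*` depends only on the subspace. -/
lemma nustar_eq_of_map_bminus {n : ℕ} (hn : n ≠ 0) {h k : Mn n} (hh : h.det = 1) (hk : k.det = 1)
    (H : (bminus n).map (AdM h) = (bminus n).map (AdM k)) {Z : Mn n}
    (hZ : Z ∈ (bminus n).map (AdM k)) : nustar h Z = nustar k Z := by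
  obtain ⟨w, hw, rfl⟩ := hZ
  have hd := det_inv_mul hh hk
  rw [nustar_AdM_self hk, nustar_AdM]
  exact congrArg Matrix.diagonal (funext (conj_diag_of_loTri (inv_mul_self_of_det hd)
    (AdM_mem_of_inf_slSub hn hd (one_mem_loTri n) (one_mem_loTri n) (AdM_inv_mul_mem hh H)) hw.2))

/-- Exchanging the roles of `𝔟⁺` and `𝔟⁻` twists `ν*` by `ω₀`. -/
lemma nustar_eq_omega0_of_map_bplus_eq_map_bminus {n : ℕ} (hn : n ≠ 0) {h k : Mn n}
    (hh : h.det = 1) (hk : k.det = 1)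
    (H : (bplus n).map (AdM h) = (bminus n).map (AdM k)) {Z : Mn n}
    (hZ : Z ∈ (bplus n).map (AdM h)) : nustar k Z = omega0 (nustar h Z) := by
  obtain ⟨w, hw, rfl⟩ := hZ
  have hd := det_inv_mul hk hh
  rw [nustar_AdM_self hh, nustar_AdM]
  refine congrArg Matrix.diagonal (funext fun i => ?_)
  refine (conj_diag_of_upTri_loTri (inv_mul_self_of_det hd) (AdM_mem_of_inf_slSub hn hd
    (one_mem_upTri n) (one_mem_loTri n) (AdM_inv_mul_mem hk H.symm)) hw.2 i).trans ?_
  simp [pi0]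

lemma omega0_omega0_nustar {n : ℕ} (h Z : Mn n) :
    omega0 (omega0 (nustar h Z)) = nustar h Z := by
  simp [omega0, nustar, pi0]

/-- The Margulis invariant is the `ν*`-component of the displacement at any point. -/
lemma nustar_displacement {n : ℕ} {h : Mn n} (hh : h.det = 1) {d : Fin n → ℝ}
    (hd : (Matrix.diagonal d).det = 1) (Y Z : Mn n) :
    nustar h (affMap (h * Matrix.diagonal d * h⁻¹) Y Z - Z) = pi0 (h⁻¹ * Y * h) := by
  have hZ : affMap (h * Matrix.diagonal d * h⁻¹) Y Z
      = AdM h (AdM (Matrix.diagonal d) (AdM h⁻¹ Z)) + AdM h (AdM h⁻¹ Y) := by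
    rw [AdM_AdM_inv hh, ← LinearMap.comp_apply, ← LinearMap.comp_apply, ← AdM_mul, ← AdM_mul,
      AdM_apply, affMap]
  have hY : AdM h⁻¹ Y = h⁻¹ * Y * h := by
    rw [AdM_apply, Matrix.nonsing_inv_nonsing_inv h (by simp [hh])]
  conv_lhs => rw [hZ, ← AdM_AdM_inv hh Z, AdM_inv_AdM hh]
  rw [map_sub, map_add, nustar_AdM_self hh, nustar_AdM_self hh, nustar_AdM_self hh,
    pi0_AdM_diagonal hd, add_sub_cancel_left, hY]


/-- Let g = h·exp(a)·h⁻¹ ∈ SLₙ(ℝ) be loxodromic of positive type, let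
Y ∈ 𝔰𝔩ₙ(ℝ) and φ = (g,Y) the corresponding affine transformation of 𝔰𝔩ₙ(ℝ). Suppose A₊
and A₋ are affine parabolic spaces with directions Ad(h)𝔟⁺ and Ad(h)𝔟⁻ fixed by φ, and A
is any affine parabolic space transverse to A₊ and A₋ with φ(A) transverse to A. Then
A₊, A₋, φ(A), A are pairwise transverse affine parabolic spaces and
β(A₊, A₋, φ(A), A) = M(g,Y) − ω₀ M(g,Y). -/
theorem affine_cross_ratio_equals_margulis_invariant (n : ℕ) (hn : 2 ≤ n)
    (h : Mn n) (hdet : h.det = 1)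
    (a : Fin n → ℝ) (ha : ∑ i, a i = 0) (hstrict : StrictAnti a)
    (Y : Mn n) (hY : Y.trace = 0)
    (Ap Am A : Set (Mn n)) (V : Submodule ℝ (Mn n))
    (hAp : IsAffPara Ap ((bplus n).map (AdM h)))
    (hAm : IsAffPara Am ((bminus n).map (AdM h)))
    (hA : IsAffPara A V)
    (hfixp : affMap (h * Matrix.diagonal (fun i => Real.exp (a i)) * h⁻¹) Y '' Ap = Ap)
    (hfixm : affMap (h * Matrix.diagonal (fun i => Real.exp (a i)) * h⁻¹) Y '' Am = Am)
    (htp : Transv V ((bplus n).map (AdM h)))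
    (htm : Transv V ((bminus n).map (AdM h)))
    (htg : Transv
      (V.map (AdM (h * Matrix.diagonal (fun i => Real.exp (a i)) * h⁻¹))) V) :
    IsAffPara
      (affMap (h * Matrix.diagonal (fun i => Real.exp (a i)) * h⁻¹) Y '' A)
      (V.map (AdM (h * Matrix.diagonal (fun i => Real.exp (a i)) * h⁻¹))) ∧
    (Transv ((bplus n).map (AdM h)) ((bminus n).map (AdM h)) ∧
     Transv ((bplus n).map (AdM h))
       (V.map (AdM (h * Matrix.diagonal (fun i => Real.exp (a i)) * h⁻¹))) ∧
     Transv ((bplus n).map (AdM h)) V ∧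
     Transv ((bminus n).map (AdM h))
       (V.map (AdM (h * Matrix.diagonal (fun i => Real.exp (a i)) * h⁻¹))) ∧
     Transv ((bminus n).map (AdM h)) V ∧
     Transv (V.map (AdM (h * Matrix.diagonal (fun i => Real.exp (a i)) * h⁻¹))) V) ∧
    ∀ b : Mn n,
      IsCross b Ap Am
        (affMap (h * Matrix.diagonal (fun i => Real.exp (a i)) * h⁻¹) Y '' A) A
        ((bplus n).map (AdM h)) ((bminus n).map (AdM h))
        (V.map (AdM (h * Matrix.diagonal (fun i => Real.exp (a i)) * h⁻¹))) V →
      b = pi0 (h⁻¹ * Y * h) - omega0 (pi0 (h⁻¹ * Y * h)) := by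
  have hn0 : n ≠ 0 := by omega
  have hd : (Matrix.diagonal fun i => Real.exp (a i)).det = 1 := by
    rw [Matrix.det_diagonal, ← Real.exp_sum, ha, Real.exp_zero]
  have hVp := map_AdM_conj hdet (map_AdM_diagonal_bplus hd)
  have hVm := map_AdM_conj hdet (map_AdM_diagonal_bminus hd)
  have hg := det_conj_diagonal hdet hd
  have hdisp := nustar_displacement hdet hd Y
  set g := h * Matrix.diagonal (fun i => Real.exp (a i)) * h⁻¹
  have hgp := (htp.map_AdM hg).symm
  have hgm := (htm.map_AdM hg).symm
  rw [hVp] at hgp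
  rw [hVm] at hgm
  refine ⟨hA.image_affMap hg hY, ⟨(transv_bplus_bminus n).map_AdM hdet, hgp, htp.symm, hgm,
    htm.symm, htg⟩, ?_⟩
  rintro b ⟨k, l, _, Z, ⟨hk, hkp, hkm⟩, ⟨hl, hlp, hlm⟩, ⟨hXp, X, hX, rfl⟩, ⟨hZm, hZ⟩, rfl⟩
  have hXp' : X ∈ Ap := by
    rw [← hfixp] at hXp
    exact (affMap_injective hg Y).mem_set_image.1 hXp
  have hZm' : affMap g Y Z ∈ Am := hfixm ▸ Set.mem_image_of_mem _ hZm
  have hXZ : X - Z ∈ V := hA.sub_mem hX hZ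
  have hp : nustar k (affMap g Y X - X) = pi0 (h⁻¹ * Y * h) := by
    rw [nustar_eq_of_map_bplus hn0 hk hdet hkp (hAp.sub_mem hXp hXp'), hdisp]
  have hm : nustar l (affMap g Y Z - Z) = omega0 (pi0 (h⁻¹ * Y * h)) := by
    rw [← hdisp Z, nustar_eq_omega0_of_map_bplus_eq_map_bminus hn0 hl hdet hlp
      (hlp ▸ hAm.sub_mem hZm' hZm), omega0_omega0_nustar]
  have hmid : nustar l (affMap g Y X - affMap g Y Z) = nustar k (X - Z) := by
    have hkV : (bminus n).map (AdM (g⁻¹ * l)) = (bminus n).map (AdM k) := by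
      rw [map_AdM_mul, hlm, ← Submodule.map_comp, AdM_inv_comp hg, Submodule.map_id, hkm]
    rw [← nustar_eq_of_map_bminus hn0 (det_inv_mul hg hl) hk hkV (hkm ▸ hXZ),
      affMap_sub_affMap, nustar_AdM, nustar, LinearMap.comp_apply, Matrix.mul_inv_rev,
      Matrix.nonsing_inv_nonsing_inv g (by simp [hg])]
  have h1 : affMap g Y X - Z = (affMap g Y X - X) + (X - Z) := by abel
  have h2 : affMap g Y X - Z = (affMap g Y X - affMap g Y Z) + (affMap g Y Z - Z) := by abel
  have e1 := congrArg (nustar k) h1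
  have e2 := congrArg (nustar l) h2
  rw [map_add, hp] at e1
  rw [map_add, hm, hmid] at e2
  rw [e1, e2]
  abel


end
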